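/- arXiv:1611.05256 — 2 statements merged into one kernel-verified Lean document; each statement's English description precedes it below -/
import Mathlib

section
/- For every integer n ≥ 2, the generalized q-Fibonacci polynomials satisfy the recurrence F_n(x,t,q) = x · F_{n−1}(x,qt,q) − q^{⌊(n−1)/2⌋} τ_{n−2}(t) F_{n−2}(x,t,q) in ℚ(q)[t,x], where F_{n−1}(x,qt,q) denotes the result of substituting qt for t, and where τ_m(t) = 1 if m is even and τ_m(t) = t if m is odd. Moreover F_0(x,t,q) = 1 and F_1(x,t,q) = x. -/
open Finset Polynomial

/-- The field `ℚ(q)` of rational functions. -/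
noncomputable abbrev K : Type := RatFunc ℚ

/-- The indeterminate `q`, viewed in `ℚ(q)`. -/
noncomputable def q : K := RatFunc.X

/-- The Gaussian binomial coefficient `[n choose k]_q` in `ℚ(q)`; it is `0` for `k < 0`
or `k > n`, with the convention `[m choose 0]_q = 1` for every integer `m`. -/
noncomputable def qbinom (n k : ℤ) : K :=
  if 0 ≤ k ∧ k ≤ n then
    ∏ i ∈ Finset.range k.toNat, (1 - q ^ (n - k + (i : ℤ) + 1)) / (1 - q ^ ((i : ℤ) + 1))
  else if k = 0 then 1 else 0

/-- The generalized q-Fibonacci polynomials `F_n(x,t,q)`, viewed as elements of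
`ℚ(q)[t][x]` (the outer variable is `x`, the inner one is `t`). -/
noncomputable def genF (n : ℕ) : Polynomial (Polynomial K) :=
  if n % 2 = 0 then
    ∑ k ∈ Finset.range (n / 2 + 1),
      Polynomial.C (((-1 : K) ^ k * q ^ (k * (k - 1) / 2)) •
        ∑ j ∈ Finset.range (k + 1),
          Polynomial.C (qbinom ((n / 2 : ℕ) - (j : ℤ)) ((k : ℤ) - j) *
              qbinom ((n / 2 : ℕ) - (k : ℤ) + j - 1) j * q ^ ((n / 2 - k + 1) * j)) *
            Polynomial.X ^ j) *
        Polynomial.X ^ (2 * (n / 2) - 2 * k)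
  else
    ∑ k ∈ Finset.range (n / 2 + 1),
      Polynomial.C (((-1 : K) ^ k * q ^ (k * (k - 1) / 2)) •
        ∑ j ∈ Finset.range (k + 1),
          Polynomial.C (qbinom ((n / 2 : ℕ) - (j : ℤ)) ((k : ℤ) - j) *
              qbinom ((n / 2 : ℕ) - (k : ℤ) + j) j * q ^ ((n / 2 - k + 1) * j)) *
            Polynomial.X ^ j) *
        Polynomial.X ^ (2 * (n / 2) + 1 - 2 * k)

/-- The ring homomorphism `ℚ(q)[t] → ℚ(q)[t]` substituting `qt` for `t`. -/
noncomputable def substQt : Polynomial K →+* Polynomial K :=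
  (Polynomial.aeval (Polynomial.C q * Polynomial.X : Polynomial K)).toRingHom

/-- `τ_m(t) = 1` if `m` is even and `τ_m(t) = t` if `m` is odd, as an element of `ℚ(q)[t]`. -/
noncomputable def tauSimple (m : ℕ) : Polynomial K :=
  if m % 2 = 0 then 1 else Polynomial.X

lemma one_sub_q_pow_ne_zero (k : ℕ) : (1 : K) - q ^ (k + 1) ≠ 0 := by
  intro h
  have hX : (RatFunc.X : RatFunc ℚ) = algebraMap ℚ[X] (RatFunc ℚ) X := RatFunc.algebraMap_X.symm
  rw [sub_eq_zero, q, hX, ← map_pow, ← map_one (algebraMap ℚ[X] (RatFunc ℚ))] at h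
  have h' := congrArg (Polynomial.eval 0) (RatFunc.algebraMap_injective ℚ h)
  simp at h'

lemma qbinom_zero_right (m : ℤ) : qbinom m 0 = 1 := by
  simp [qbinom]

lemma qbinom_of_neg (m : ℤ) {k : ℤ} (hk : k < 0) : qbinom m k = 0 := by
  rw [qbinom, if_neg (by omega), if_neg (by omega)]

lemma qbinom_of_lt {m k : ℤ} (hk : k ≠ 0) (h : m < k) : qbinom m k = 0 := by
  rw [qbinom, if_neg (by omega), if_neg hk]

lemma qbinom_add_eq_prod (m k : ℕ) :
    qbinom (m + k) k = ∏ i ∈ range k, (1 - q ^ (m + i + 1)) / (1 - q ^ (i + 1)) := by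
  rw [qbinom, if_pos (by omega), Int.toNat_natCast]
  refine prod_congr rfl fun i _ => ?_
  rw [add_sub_cancel_right]
  norm_cast

lemma qbinom_self (k : ℕ) : qbinom k k = 1 := by
  have h := qbinom_add_eq_prod 0 k
  simp only [Nat.cast_zero, zero_add] at h
  rw [h]
  exact prod_eq_one fun i _ => div_self (one_sub_q_pow_ne_zero i)

lemma qbinom_succ_mul (m k : ℕ) :
    qbinom (m + (k + 1 : ℕ)) (k + 1 : ℕ) * (1 - q ^ (k + 1)) =
      qbinom (m + k) k * (1 - q ^ (m + k + 1)) := by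
  rw [qbinom_add_eq_prod, qbinom_add_eq_prod, prod_range_succ]
  field_simp [one_sub_q_pow_ne_zero k]

lemma qbinom_succ_mul' (m k : ℕ) :
    qbinom (m + (k + 1 : ℕ)) (k + 1 : ℕ) * (1 - q ^ (k + 1)) =
      qbinom ((m + 1 : ℕ) + k) k * (1 - q ^ (m + 1)) := by
  rw [qbinom_add_eq_prod, qbinom_add_eq_prod, prod_div_distrib, prod_div_distrib,
    prod_range_succ', prod_range_succ (fun i => (1 : K) - q ^ (i + 1))]
  have h : ∏ i ∈ range k, ((1 : K) - q ^ (i + 1)) ≠ 0 :=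
    prod_ne_zero_iff.2 fun i _ => one_sub_q_pow_ne_zero i
  have h' := one_sub_q_pow_ne_zero k
  have e : ∏ i ∈ range k, ((1 : K) - q ^ (m + (i + 1) + 1)) =
      ∏ i ∈ range k, ((1 : K) - q ^ (m + 1 + i + 1)) :=
    prod_congr rfl fun i _ => by ring_nf
  rw [e, add_zero]
  field_simp

/-- The q-Pascal rule `[m+k, k] = [m+k-1, k] + q^m [m+k-1, k-1]`. -/
lemma qbinom_pascal (m k : ℕ) :
    qbinom (m + k) k = qbinom (m + k - 1) k + q ^ m * qbinom (m + k - 1) (k - 1) := by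
  rcases k with _ | k
  · simp [qbinom_zero_right, qbinom_of_neg]
  rcases m with _ | m
  · have h := qbinom_self (k + 1)
    have h' := qbinom_self k
    have h0 : qbinom k (k + 1) = 0 := qbinom_of_lt (by omega) (by omega)
    push_cast at h
    simp [h, h', h0]
  · have h1 := qbinom_succ_mul (m + 1) k
    have h2 := qbinom_succ_mul' m k
    have e1 : ((m + 1 : ℕ) : ℤ) + (k + 1 : ℕ) - 1 = m + (k + 1 : ℕ) := by push_cast; ring
    have e2 : ((k + 1 : ℕ) : ℤ) - 1 = k := by push_cast; ring
    have e3 : ((m + 1 : ℕ) : ℤ) + k = m + (k + 1 : ℕ) := by push_cast; ring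
    rw [e3] at h1 h2
    rw [e1, e2]
    refine mul_right_cancel₀ (one_sub_q_pow_ne_zero k) ?_
    linear_combination h1 - h2

/-- The q-Pascal rule `[m+k, k] = q^k [m+k-1, k] + [m+k-1, k-1]`. -/
lemma qbinom_pascal' (m k : ℕ) :
    qbinom (m + k) k = q ^ k * qbinom (m + k - 1) k + qbinom (m + k - 1) (k - 1) := by
  rcases k with _ | k
  · simp [qbinom_zero_right, qbinom_of_neg]
  rcases m with _ | m
  · have h := qbinom_self (k + 1)
    have h' := qbinom_self k
    have h0 : qbinom k (k + 1) = 0 := qbinom_of_lt (by omega) (by omega)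
    push_cast at h
    simp [h, h', h0]
  · have h1 := qbinom_succ_mul (m + 1) k
    have h2 := qbinom_succ_mul' m k
    have e1 : ((m + 1 : ℕ) : ℤ) + (k + 1 : ℕ) - 1 = m + (k + 1 : ℕ) := by push_cast; ring
    have e2 : ((k + 1 : ℕ) : ℤ) - 1 = k := by push_cast; ring
    have e3 : ((m + 1 : ℕ) : ℤ) + k = m + (k + 1 : ℕ) := by push_cast; ring
    rw [e3] at h1 h2
    rw [e1, e2]
    refine mul_right_cancel₀ (one_sub_q_pow_ne_zero k) ?_
    linear_combination h1 - q ^ (k + 1) * h2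

/-- The sign and power of `q` in front of the `k`-th coefficient of `genF`. -/
noncomputable def signCoeff (k : ℕ) : K := (-1 : K) ^ k * q ^ (k * (k - 1) / 2)

lemma signCoeff_succ (k : ℕ) : signCoeff (k + 1) = -(q ^ k * signCoeff k) := by
  rw [signCoeff, signCoeff, Nat.triangle_succ]
  ring

/-- The coefficient of `t^j x^(2n-2k)` in `F_{2n}`, up to `signCoeff k`. -/
noncomputable def evenTerm (n k j : ℕ) : K :=
  qbinom (n - (j : ℤ)) ((k : ℤ) - j) * qbinom (n - (k : ℤ) + j - 1) j * q ^ ((n - k + 1) * j)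

/-- The coefficient of `t^j x^(2n+1-2k)` in `F_{2n+1}`, up to `signCoeff k`. -/
noncomputable def oddTerm (n k j : ℕ) : K :=
  qbinom (n - (j : ℤ)) ((k : ℤ) - j) * qbinom (n - (k : ℤ) + j) j * q ^ ((n - k + 1) * j)

/-- The coefficient of `x^(2n-2k)` in `F_{2n}`. -/
noncomputable def evenCoeff (n k : ℕ) : K[X] :=
  signCoeff k • ∑ j ∈ range (k + 1), C (evenTerm n k j) * X ^ j

/-- The coefficient of `x^(2n+1-2k)` in `F_{2n+1}`. -/
noncomputable def oddCoeff (n k : ℕ) : K[X] :=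
  signCoeff k • ∑ j ∈ range (k + 1), C (oddTerm n k j) * X ^ j

lemma genF_even (n : ℕ) :
    genF (2 * n) = ∑ k ∈ range (n + 1), C (evenCoeff n k) * X ^ (2 * n - 2 * k) := by
  have h : 2 * n / 2 = n := by omega
  rw [genF, if_pos (by omega), h]
  rfl

lemma genF_odd (n : ℕ) :
    genF (2 * n + 1) = ∑ k ∈ range (n + 1), C (oddCoeff n k) * X ^ (2 * n + 1 - 2 * k) := by
  have h : (2 * n + 1) / 2 = n := by omega
  rw [genF, if_neg (by omega), h]
  rfl

lemma substQt_smul_sum (c : K) (f : ℕ → K) (s : Finset ℕ) :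
    substQt (c • ∑ j ∈ s, C (f j) * X ^ j) = c • ∑ j ∈ s, C (q ^ j * f j) * X ^ j := by
  simp only [substQt, AlgHom.toRingHom_eq_coe, RingHom.coe_coe, map_smul, map_sum, map_mul,
    aeval_C, map_pow, aeval_X, mul_pow, algebraMap_eq]
  congr 1
  exact sum_congr rfl fun j _ => by ring

lemma evenTerm_eq_zero_of_lt {n k j : ℕ} (h : k < j) : evenTerm n k j = 0 := by
  rw [evenTerm, qbinom_of_neg _ (by omega : (k : ℤ) - j < 0), zero_mul, zero_mul]

lemma oddTerm_succ_self (n j : ℕ) : oddTerm n (n + 1) j = 0 := by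
  rw [oddTerm]
  rcases j with _ | j
  · rw [qbinom_of_lt (by push_cast; omega) (by push_cast; omega), zero_mul, zero_mul]
  · rw [qbinom_of_lt (k := (j + 1 : ℕ)) (by omega) (by push_cast; omega), mul_zero, zero_mul]

lemma oddCoeff_succ_self (n : ℕ) : oddCoeff n (n + 1) = 0 := by
  simp [oddCoeff, oddTerm_succ_self]

lemma evenTerm_succ {n k j : ℕ} (hk : k ≤ n) (hj : j ≤ k + 1) :
    evenTerm (n + 1) (k + 1) j =
      q ^ j * oddTerm n (k + 1) j + q ^ (n - k) * evenTerm n k j := by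
  obtain ⟨d, rfl⟩ := Nat.exists_eq_add_of_le hk
  obtain ⟨i, hi⟩ := Nat.exists_eq_add_of_le hj
  have hi' : (k : ℤ) + 1 = j + i := by exact_mod_cast hi
  have hp := qbinom_pascal d i
  have hodd : q ^ j * oddTerm (k + d) (k + 1) j =
      qbinom (d + i - 1) i * qbinom (d + j - 1) j * q ^ ((d + 1) * j) := by
    rcases d with _ | d
    · rw [add_zero, oddTerm_succ_self, mul_zero]
      rcases j with _ | j
      · rw [qbinom_of_lt (k := (i : ℤ)) (by omega) (by omega), zero_mul, zero_mul]
      · rw [qbinom_of_lt (k := ((j + 1 : ℕ) : ℤ)) (by omega) (by push_cast; omega), mul_zero,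
          zero_mul]
    · have e : k + (d + 1) - (k + 1) + 1 = d + 1 := by omega
      rw [oddTerm, e]
      have e1 : ((k + (d + 1) : ℕ) : ℤ) - j = (d + 1 : ℕ) + i - 1 := by push_cast; linarith
      have e2 : ((k + 1 : ℕ) : ℤ) - j = i := by push_cast; linarith
      have e3 : ((k + (d + 1) : ℕ) : ℤ) - (k + 1 : ℕ) + j = (d + 1 : ℕ) + j - 1 := by
        push_cast; ring
      rw [e1, e2, e3]
      ring
  have e : k + d + 1 - (k + 1) + 1 = d + 1 := by omega
  have e0 : k + d - k = d := by omega
  have e1 : ((k + d + 1 : ℕ) : ℤ) - j = d + i := by push_cast; linarith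
  have e2 : ((k + 1 : ℕ) : ℤ) - j = i := by push_cast; linarith
  have e3 : ((k + d + 1 : ℕ) : ℤ) - (k + 1 : ℕ) + j - 1 = d + j - 1 := by push_cast; ring
  have e4 : ((k + d : ℕ) : ℤ) - j = d + i - 1 := by push_cast; linarith
  have e5 : (k : ℤ) - j = i - 1 := by linarith
  have e6 : ((k + d : ℕ) : ℤ) - k + j - 1 = d + j - 1 := by push_cast; ring
  rw [hodd, evenTerm, evenTerm, e, e0, e1, e2, e3, e4, e5, e6, hp]
  ring

lemma oddTerm_zero_right (n k : ℕ) : oddTerm n k 0 = evenTerm n k 0 := by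
  simp [oddTerm, evenTerm, qbinom_zero_right]

lemma oddTerm_succ {n k : ℕ} (j : ℕ) (hk : k ≤ n) :
    oddTerm (n + 1) (k + 1) (j + 1) =
      q ^ (j + 1) * evenTerm (n + 1) (k + 1) (j + 1) + q ^ (n - k + 1) * oddTerm n k j := by
  obtain ⟨d, rfl⟩ := Nat.exists_eq_add_of_le hk
  have hp := qbinom_pascal' d (j + 1)
  have e : k + d + 1 - (k + 1) + 1 = d + 1 := by omega
  have e0 : k + d - k = d := by omega
  have e1 : ((k + d + 1 : ℕ) : ℤ) - (j + 1 : ℕ) = (k + d : ℕ) - j := by push_cast; ring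
  have e2 : ((k + 1 : ℕ) : ℤ) - (j + 1 : ℕ) = k - j := by push_cast; ring
  have e3 : ((k + d + 1 : ℕ) : ℤ) - (k + 1 : ℕ) + (j + 1 : ℕ) = d + (j + 1 : ℕ) := by
    push_cast; ring
  have e4 : ((k + d : ℕ) : ℤ) - k + j = d + (j + 1 : ℕ) - 1 := by push_cast; ring
  have e5 : ((j + 1 : ℕ) : ℤ) - 1 = j := by push_cast; ring
  rw [e5] at hp
  rw [oddTerm, evenTerm, oddTerm, e, e0, e1, e2, e3, e4, hp]
  ring

lemma evenCoeff_zero_right (n m : ℕ) : evenCoeff n 0 = substQt (oddCoeff m 0) := by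
  rw [oddCoeff, substQt_smul_sum]
  simp [evenCoeff, evenTerm, oddTerm, qbinom_zero_right]

lemma oddCoeff_zero_right (n m : ℕ) : oddCoeff n 0 = substQt (evenCoeff m 0) := by
  rw [evenCoeff, substQt_smul_sum]
  simp [oddCoeff, evenTerm, oddTerm, qbinom_zero_right]

lemma evenCoeff_succ {n k : ℕ} (hk : k ≤ n) :
    evenCoeff (n + 1) (k + 1) = substQt (oddCoeff n (k + 1)) - C (q ^ n) * evenCoeff n k := by
  have hext : ∑ j ∈ range (k + 1), C (evenTerm n k j) * X ^ j =
      ∑ j ∈ range (k + 1 + 1), C (evenTerm n k j) * X ^ j := by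
    rw [sum_range_succ _ (k + 1), evenTerm_eq_zero_of_lt (Nat.lt_succ_self k)]
    simp
  rw [oddCoeff, substQt_smul_sum, evenCoeff, evenCoeff, hext, signCoeff_succ]
  simp only [smul_eq_C_mul, mul_sum, ← sum_sub_distrib]
  refine sum_congr rfl fun j hj => ?_
  rw [evenTerm_succ hk (by rw [mem_range] at hj; omega)]
  have hq : (q : K) ^ n = q ^ k * q ^ (n - k) := by rw [← pow_add]; congr 1; omega
  rw [hq]
  simp only [map_mul, map_add, map_neg]
  ring

lemma oddCoeff_succ {n k : ℕ} (hk : k ≤ n) :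
    oddCoeff (n + 1) (k + 1) =
      substQt (evenCoeff (n + 1) (k + 1)) - C (q ^ (n + 1)) * X * oddCoeff n k := by
  rw [evenCoeff, substQt_smul_sum, oddCoeff, oddCoeff, signCoeff_succ,
    sum_range_succ' _ (k + 1), sum_range_succ' _ (k + 1), oddTerm_zero_right, pow_zero q, one_mul]
  simp only [smul_eq_C_mul, mul_add, mul_sum]
  rw [add_sub_right_comm, ← sum_sub_distrib]
  congr 1
  refine sum_congr rfl fun j _ => ?_
  rw [oddTerm_succ j hk]
  have hq : (q : K) ^ (n + 1) = q ^ k * q ^ (n - k + 1) := by rw [← pow_add]; congr 1; omega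
  rw [hq]
  simp only [map_mul, map_add, map_neg]
  ring

lemma genF_even_succ (n : ℕ) :
    genF (2 * n + 2) =
      X * (genF (2 * n + 1)).map substQt - C (C (q ^ n)) * genF (2 * n) := by
  have hext : genF (2 * n + 1) =
      ∑ k ∈ range (n + 1 + 1), C (oddCoeff n k) * X ^ (2 * n + 1 - 2 * k) := by
    rw [sum_range_succ _ (n + 1), oddCoeff_succ_self, genF_odd]
    simp
  have h := genF_even (n + 1)
  rw [mul_add, mul_one] at h
  rw [h, hext, genF_even, sum_range_succ', sum_range_succ' _ (n + 1), evenCoeff_zero_right _ n]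
  simp only [Polynomial.map_add, Polynomial.map_sum, Polynomial.map_mul, Polynomial.map_pow,
    Polynomial.map_C, Polynomial.map_X, mul_add, mul_sum]
  rw [add_sub_right_comm, ← sum_sub_distrib]
  congr 1
  · refine sum_congr rfl fun k hk => ?_
    have hk' : k ≤ n := by rw [mem_range] at hk; omega
    rw [evenCoeff_succ hk']
    rcases hk'.eq_or_lt with rfl | hlt
    · rw [oddCoeff_succ_self]
      have e : 2 * k + 2 - (2 * k + 2 * 1) = 2 * k - 2 * k := by omega
      rw [e]
      simp only [map_sub, map_mul, map_zero]
      ring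
    · have e1 : 2 * n + 2 - (2 * k + 2 * 1) = 2 * n + 1 - (2 * k + 2 * 1) + 1 := by omega
      have e2 : 2 * n - 2 * k = 2 * n + 1 - (2 * k + 2 * 1) + 1 := by omega
      rw [e1, e2]
      simp only [map_sub, map_mul]
      ring
  · simp only [mul_zero, Nat.sub_zero]
    ring

lemma genF_odd_succ (n : ℕ) :
    genF (2 * n + 3) =
      X * (genF (2 * n + 2)).map substQt - C (C (q ^ (n + 1)) * X) * genF (2 * n + 1) := by
  have h := genF_even (n + 1)
  have h' := genF_odd (n + 1)
  rw [mul_add, mul_one] at h h'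
  rw [show 2 * n + 3 = 2 * n + 2 + 1 from rfl, h, h', genF_odd, sum_range_succ',
    sum_range_succ' _ (n + 1), oddCoeff_zero_right _ (n + 1)]
  simp only [Polynomial.map_add, Polynomial.map_sum, Polynomial.map_mul, Polynomial.map_pow,
    Polynomial.map_C, Polynomial.map_X, mul_add, mul_sum]
  rw [add_sub_right_comm, ← sum_sub_distrib]
  congr 1
  · refine sum_congr rfl fun k hk => ?_
    have hk' : k ≤ n := by rw [mem_range] at hk; omega
    rw [oddCoeff_succ hk']
    have e1 : 2 * n + 2 + 1 - (2 * k + 2 * 1) = 2 * n + 2 - (2 * k + 2 * 1) + 1 := by omega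
    have e2 : 2 * n + 1 - 2 * k = 2 * n + 2 - (2 * k + 2 * 1) + 1 := by omega
    rw [e1, e2]
    simp only [map_sub, map_mul]
    ring
  · simp only [mul_zero, Nat.sub_zero]
    ring

/-- The generalized q-Fibonacci polynomials satisfy the recurrence
`F_n(x,t,q) = x F_{n−1}(x,qt,q) − q^{⌊(n−1)/2⌋} τ_{n−2}(t) F_{n−2}(x,t,q)`,
with `F_0 = 1` and `F_1 = x`. -/
theorem genF_recurrence :
    (∀ n : ℕ, 2 ≤ n →
      genF n = Polynomial.X * (genF (n - 1)).map substQt -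
        Polynomial.C (Polynomial.C (q ^ ((n - 1) / 2)) * tauSimple (n - 2)) * genF (n - 2)) ∧
    genF 0 = 1 ∧ genF 1 = Polynomial.X := by
  refine ⟨fun n hn => ?_, ?_, ?_⟩
  · obtain ⟨m, rfl⟩ := Nat.exists_eq_add_of_le' hn
    rcases Nat.even_or_odd' m with ⟨r, rfl | rfl⟩
    · have e1 : 2 * r + 2 - 1 = 2 * r + 1 := by omega
      have e2 : (2 * r + 1) / 2 = r := by omega
      rw [Nat.add_sub_cancel, e1, e2, tauSimple, if_pos (by omega), mul_one, genF_even_succ]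
    · have e1 : 2 * r + 1 + 2 - 1 = 2 * r + 2 := by omega
      have e2 : (2 * r + 2) / 2 = r + 1 := by omega
      rw [Nat.add_sub_cancel, e1, e2, tauSimple, if_neg (by omega), genF_odd_succ]
  · simp [genF, qbinom_zero_right]
  · simp [genF, qbinom_zero_right]
end

section
/- For all integers n ≥ 0, k ≥ 0 and j ≥ 0, the identity ([k+1]/[n+1]) [n+1 choose j]_q [n+1 choose k+j+1]_q = [n choose j]_q [n choose k+j]_q − q^{k+1} [n choose j−1]_q [n choose k+j+1]_q holds in ℚ(q). -/
open Finset

/-- `[n] = (1 - q^n)/(1 - q)` in `ℚ(q)`. -/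
noncomputable def qint (n : ℕ) : K := (1 - q ^ n) / (1 - q)

/-- The `q`-Pochhammer product `(1 - q)(1 - q^2)⋯(1 - q^n)`. -/
noncomputable def qpoch (n : ℕ) : K := ∏ i ∈ Finset.range n, (1 - q ^ (i + 1))

theorem one_sub_q_pow_succ_ne_zero (n : ℕ) : (1 : K) - q ^ (n + 1) ≠ 0 := by
  intro h
  have h1 : (algebraMap (Polynomial ℚ) K) (Polynomial.X ^ (n + 1)) = algebraMap _ _ 1 := by
    rw [map_pow, map_one, RatFunc.algebraMap_X]
    exact (sub_eq_zero.mp h).symm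
  have h2 := congrArg Polynomial.natDegree (RatFunc.algebraMap_injective ℚ h1)
  simp at h2

theorem qpoch_succ (n : ℕ) : qpoch (n + 1) = qpoch n * (1 - q ^ (n + 1)) :=
  Finset.prod_range_succ _ _

theorem qpoch_ne_zero (n : ℕ) : qpoch n ≠ 0 :=
  Finset.prod_ne_zero_iff.mpr fun i _ => one_sub_q_pow_succ_ne_zero i

theorem qpoch_add (a b : ℕ) :
    qpoch (a + b) = qpoch a * ∏ i ∈ Finset.range b, (1 - q ^ (a + i + 1)) :=
  Finset.prod_range_add _ _ _

theorem qbinom_eq_zero_of_neg {n k : ℤ} (h : k < 0) : qbinom n k = 0 := by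
  rw [qbinom, if_neg (by omega), if_neg (by omega)]

theorem qbinom_eq_zero_of_lt {n k : ℤ} (hk : 0 < k) (h : n < k) : qbinom n k = 0 := by
  rw [qbinom, if_neg (by omega), if_neg (by omega)]

theorem qbinom_eq_div {n k : ℤ} (a b : ℕ) (hn : n = a + b) (hk : k = b) :
    qbinom n k = qpoch (a + b) / (qpoch a * qpoch b) := by
  subst hn hk
  rw [qbinom, if_pos (by omega), Finset.prod_div_distrib, qpoch_add,
    mul_div_mul_left _ _ (qpoch_ne_zero a), Int.toNat_natCast, qpoch]
  congr 1
  refine Finset.prod_congr rfl fun i _ => ?_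
  rw [add_sub_cancel_right]
  norm_cast

theorem qbinom_pred_eq_div {n k : ℤ} (a b : ℕ) (hn : n = a + b) (hk : k = (b : ℤ) - 1) :
    qbinom n k = (1 - q ^ b) * qpoch (a + b) / (qpoch (a + 1) * qpoch b) := by
  cases b with
  | zero => rw [qbinom_eq_zero_of_neg (by omega)]; simp
  | succ b =>
    rw [qbinom_eq_div (a + 1) b (by omega) (by omega), qpoch_succ b,
      show a + 1 + b = a + (b + 1) by omega]
    have := one_sub_q_pow_succ_ne_zero b
    have := qpoch_ne_zero b
    have := qpoch_ne_zero (a + 1)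
    field_simp

theorem qbinom_succ_eq_div {n k : ℤ} (a b : ℕ) (hn : n = a + b) (hk : k = b + 1) :
    qbinom n k = (1 - q ^ a) * qpoch (a + b) / (qpoch a * qpoch (b + 1)) := by
  cases a with
  | zero => rw [qbinom_eq_zero_of_lt (by omega) (by omega)]; simp
  | succ a =>
    rw [qbinom_eq_div a (b + 1) (by omega) (by omega), qpoch_succ a,
      show a + 1 + b = a + (b + 1) by omega]
    have := one_sub_q_pow_succ_ne_zero a
    have := qpoch_ne_zero a
    have := qpoch_ne_zero (b + 1)
    field_simp

/-- `([k+1]/[n+1]) [n+1 choose j][n+1 choose k+j+1]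
 = [n choose j][n choose k+j] − q^{k+1} [n choose j−1][n choose k+j+1]`. -/
theorem qbinom_threeterm (n k j : ℕ) :
    (qint (k + 1) / qint (n + 1)) * qbinom ((n : ℤ) + 1) j * qbinom ((n : ℤ) + 1) ((k : ℤ) + j + 1) =
      qbinom n j * qbinom n ((k : ℤ) + j) -
        q ^ (k + 1) * qbinom n ((j : ℤ) - 1) * qbinom n ((k : ℤ) + j + 1) := by
  rcases lt_or_ge n (k + j) with h | h
  · rw [qbinom_eq_zero_of_lt (n := n) (k := (k : ℤ) + j) (by omega) (by omega),
      qbinom_eq_zero_of_lt (n := n) (k := (k : ℤ) + j + 1) (by omega) (by omega),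
      qbinom_eq_zero_of_lt (n := (n : ℤ) + 1) (k := (k : ℤ) + j + 1) (by omega) (by omega)]
    simp
  obtain ⟨m, rfl⟩ := Nat.exists_eq_add_of_le h
  rw [qbinom_eq_div (k + m + 1) j (by push_cast; ring) rfl,
    qbinom_eq_div (n := ((k + j + m : ℕ) : ℤ) + 1) m (k + j + 1) (by push_cast; ring)
      (by push_cast; ring),
    qbinom_eq_div (k + m) j (by push_cast; ring) rfl,
    qbinom_eq_div m (k + j) (by push_cast; ring) (by push_cast; ring),
    qbinom_pred_eq_div (k + m) j (by push_cast; ring) rfl,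
    qbinom_succ_eq_div m (k + j) (by push_cast; ring) (by push_cast; ring),
    show k + m + 1 + j = k + j + m + 1 by omega, show m + (k + j + 1) = k + j + m + 1 by omega,
    show k + m + j = k + j + m by omega, show m + (k + j) = k + j + m by omega,
    qpoch_succ (k + j + m), qpoch_succ (k + m), qpoch_succ (k + j), qint, qint]
  have h1 : (1 : K) - q ≠ 0 := by simpa using one_sub_q_pow_succ_ne_zero 0
  have h2 := one_sub_q_pow_succ_ne_zero (k + j + m)
  have h3 := one_sub_q_pow_succ_ne_zero (k + m)
  have h4 := one_sub_q_pow_succ_ne_zero (k + j)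
  have h5 := qpoch_ne_zero j
  have h6 := qpoch_ne_zero m
  have h7 := qpoch_ne_zero (k + m)
  have h8 := qpoch_ne_zero (k + j)
  have key : ((1 : K) - q ^ (k + 1)) * (1 - q ^ (k + j + m + 1)) =
      (1 - q ^ (k + m + 1)) * (1 - q ^ (k + j + 1)) -
        q ^ (k + 1) * (1 - q ^ j) * (1 - q ^ m) := by ring
  generalize (1 : K) - q ^ (k + j + m + 1) = A at *
  generalize (1 : K) - q ^ (k + m + 1) = B at *
  generalize (1 : K) - q ^ (k + j + 1) = C at *
  generalize (1 : K) - q ^ j = D at *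
  generalize (1 : K) - q ^ m = E at *
  generalize q ^ (k + 1) = Q at *
  field_simp
  linear_combination qpoch (k + j + m) ^ 2 * key
end
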